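/- arXiv:1806.09206 — 3 statements merged into one kernel-verified Lean document; each statement's English description precedes it below -/
import Mathlib

section
/- Let G be a graph on m vertices with adjacency matrix A ∈ {0,1}^{m×m}, and for each vertex i let f_i ∈ ℝ^r be its vertex embedding. Let F ∈ ℝ^{r×m} be the matrix whose i-th column is f_i, and define F_(1) = F and, for n ≥ 2, F_(n) = (F_(n−1) A) ⊙ F, where ⊙ denotes the entrywise (Hadamard) product of matrices. Then for every n ≥ 1 and every vertex i, the i-th column of F_(n) equals the sum, over all walks (i_1, …, i_n) of n vertices in G with consecutive vertices adjacent and i_n = i, of the Hadamard product f_{i_1} ⊙ f_{i_2} ⊙ ⋯ ⊙ f_{i_n}. Consequently f_(n) := F_(n)·𝟙 (the sum of the columns of F_(n)) equals the sum over all walks of n vertices of the Hadamard products of the embeddings of the vertices on the walk. -/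
open scoped Classical

/-- `p` is a walk of `n` vertices in the graph with adjacency matrix `A`:
consecutive vertices are adjacent (`A` entry equal to `1`). -/
def IsWalk {m n : ℕ} (A : Matrix (Fin m) (Fin m) ℝ) (p : Fin n → Fin m) : Prop :=
  ∀ i : Fin n, ∀ h : (i : ℕ) + 1 < n, A (p i) (p ⟨(i : ℕ) + 1, h⟩) = 1

theorem isWalk_snoc_aux {m n : ℕ} (A : Matrix (Fin m) (Fin m) ℝ) (p : Fin (n+1) → Fin m)
    (x : Fin m) :
    IsWalk A (Fin.snoc (α := fun _ => Fin m) p x : Fin (n+2) → Fin m) ↔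
      IsWalk A p ∧ A (p (Fin.last n)) x = 1 := by
  have h1 : ∀ (k : ℕ) (hk : k < n+1) (hk' : k < n+2),
      (Fin.snoc (α := fun _ => Fin m) p x : Fin (n+2) → Fin m) ⟨k, hk'⟩ = p ⟨k, hk⟩ := by
    intro k hk hk'
    exact Fin.snoc_castSucc (α := fun _ => Fin m) x p ⟨k, hk⟩
  have h2 : ∀ (hk' : n+1 < n+2),
      (Fin.snoc (α := fun _ => Fin m) p x : Fin (n+2) → Fin m) ⟨n+1, hk'⟩ = x := by
    intro hk'
    exact Fin.snoc_last (α := fun _ => Fin m) x p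
  constructor
  · intro h
    refine ⟨?_, ?_⟩
    · rintro ⟨k, hk⟩ hk1
      have := h ⟨k, by omega⟩ (by simp at hk1 ⊢; omega)
      simp only at this hk1
      rwa [h1 k hk, h1 (k+1) hk1] at this
    · have := h ⟨n, by omega⟩ (by simp)
      simp only at this
      rwa [h1 n (by omega), h2] at this
  · rintro ⟨h, hx⟩ ⟨k, hk⟩ hk1
    simp only at hk1 ⊢
    rw [h1 k (by omega)]
    by_cases hkn : k = n
    · subst hkn
      rw [h2]; exact hx
    · rw [h1 (k+1) (by omega)]
      exact h ⟨k, by omega⟩ (by simp; omega)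

theorem walk_sum_aux
    (m r : ℕ) (A : Matrix (Fin m) (Fin m) ℝ)
    (hA : ∀ i j, A i j = 0 ∨ A i j = 1)
    (f : Fin m → Fin r → ℝ)
    (F : Matrix (Fin r) (Fin m) ℝ) (hF : ∀ s i, F s i = f i s)
    (Fseq : ℕ → Matrix (Fin r) (Fin m) ℝ)
    (hF1 : Fseq 1 = F)
    (hrec : ∀ n, 1 ≤ n → Fseq (n + 1) = Matrix.hadamard (Fseq n * A) F) (s : Fin r) (n : ℕ) :
    ∀ i : Fin m, Fseq (n+1) s i = ∑ p : Fin (n+1) → Fin m,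
      if IsWalk A p ∧ p (Fin.last n) = i then ∏ t, f (p t) s else 0 := by
  induction n with
  | zero =>
    intro i
    have hw : ∀ p : Fin 1 → Fin m, IsWalk A p := by
      intro p j h; omega
    rw [← (Equiv.funUnique (Fin 1) (Fin m)).symm.sum_comp]
    simp [hw, hF1, hF]
  | succ n ih =>
    intro i
    rw [hrec (n+1) (by omega), Matrix.hadamard_apply, Matrix.mul_apply, hF,
      ← (Fin.snocEquiv (fun _ : Fin (n+2) => Fin m)).sum_comp, Fintype.sum_prod_type]
    have e : ∀ (x : Fin m) (p : Fin (n+1) → Fin m),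
        Fin.snocEquiv (fun _ : Fin (n+2) => Fin m) (x, p) =
          Fin.snoc (α := fun _ => Fin m) p x := fun _ _ => rfl
    simp only [e, isWalk_snoc_aux, Fin.snoc_last, Fin.prod_univ_castSucc (n := n+1),
      Fin.snoc_castSucc]
    symm
    rw [Finset.sum_eq_single i (by intro x _ hx; simp [hx]) (by simp)]
    simp only [ih, Finset.sum_mul]
    symm
    rw [Finset.sum_comm]
    refine Finset.sum_congr rfl fun p _ => ?_
    rw [Finset.sum_eq_single (p (Fin.last n)) (by intro x _ hx; simp [hx.symm]) (by simp)]
    rcases hA (p (Fin.last n)) i with h | h <;> simp [h]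

/-- If `F₍₁₎ = F` (the matrix of vertex embeddings) and
`F₍ₙ₊₁₎ = (F₍ₙ₎ A) ⊙ F`, then for every `n ≥ 1` the `i`-th column of `F₍ₙ₎` is the sum,
over all walks of `n` vertices ending at `i`, of the Hadamard products of the embeddings
of the vertices on the walk; consequently `F₍ₙ₎·𝟙` is the sum over all walks of `n`
vertices of the Hadamard products of the embeddings on the walk. -/
theorem ngram_graph_embedding_eq_sum_over_walks
    (m r : ℕ) (A : Matrix (Fin m) (Fin m) ℝ)
    (hA : ∀ i j, A i j = 0 ∨ A i j = 1)
    (f : Fin m → Fin r → ℝ)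
    (F : Matrix (Fin r) (Fin m) ℝ) (hF : ∀ s i, F s i = f i s)
    (Fseq : ℕ → Matrix (Fin r) (Fin m) ℝ)
    (hF1 : Fseq 1 = F)
    (hrec : ∀ n, 1 ≤ n → Fseq (n + 1) = Matrix.hadamard (Fseq n * A) F) :
    ∀ n : ℕ, ∀ hn : 1 ≤ n,
      (∀ (i : Fin m) (s : Fin r),
        Fseq n s i =
          ∑ p ∈ Finset.univ.filter
              (fun p : Fin n → Fin m => IsWalk A p ∧ p ⟨n - 1, Nat.sub_lt hn one_pos⟩ = i),
            ∏ t : Fin n, f (p t) s) ∧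
      (∀ s : Fin r,
        (Fseq n).mulVec (fun _ => (1 : ℝ)) s =
          ∑ p ∈ Finset.univ.filter (fun p : Fin n → Fin m => IsWalk A p),
            ∏ t : Fin n, f (p t) s) := by
  intro n hn
  obtain ⟨n, rfl⟩ : ∃ k, n = k + 1 := ⟨n - 1, by omega⟩
  have key := fun s => walk_sum_aux m r A hA f F hF Fseq hF1 hrec s n
  refine ⟨fun i s => ?_, fun s => ?_⟩
  · rw [key, Finset.sum_filter]
    rfl
  · simp only [Matrix.mulVec, dotProduct, mul_one, key]
    rw [Finset.sum_comm, Finset.sum_filter]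
    refine Finset.sum_congr rfl fun p _ => ?_
    by_cases h : IsWalk A p <;> simp [h]
end

section
/- Let W ∈ ℝ^{r×K} be block diagonal, W = diag(U^0, …, U^{S−1}) with U^j ∈ ℝ^{r_j×k_j} and Σ_j r_j = r, and let vertex embeddings be f_i = W h_i. Fix n ≥ 1 and consider only walks p = (i_1, …, i_n) of n vertices (consecutive vertices adjacent) such that for every attribute index j the attribute values V_{i_1,j}, …, V_{i_n,j} are pairwise distinct. Let T_(n) = diag((U^0)^(n), …, (U^{S−1})^(n)) be the block-diagonal matrix whose j-th block is the n-way column Hadamard product of U^j. Then the n-gram walk-set embedding satisfies the exact linear identity f_(n) = T_(n) c_(n), where c_(n) is the bag-of-n-cooccurrences vector of the graph. -/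
open scoped Classical

/-- A walk whose attribute values are pairwise distinct within each attribute `j`. -/
def IsDistinctWalk {m S n : ℕ} {k : Fin S → ℕ} (A : Matrix (Fin m) (Fin m) ℝ)
    (V : Fin m → ∀ j : Fin S, Fin (k j)) (p : Fin n → Fin m) : Prop :=
  IsWalk A p ∧ ∀ j : Fin S, Function.Injective fun t : Fin n => V (p t) j

/-- One-hot attribute encoding `h_i ∈ ℝ^K`, `K = Σ_j k_j`. -/
def oneHot {m S : ℕ} {k : Fin S → ℕ} (V : Fin m → ∀ j : Fin S, Fin (k j))
    (i : Fin m) : ((j : Fin S) × Fin (k j)) → ℝ :=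
  fun q => if V i q.1 = q.2 then 1 else 0

/-- The block-diagonal vertex embedding matrix `W = diag(U^0, …, U^{S-1})`. -/
def blockW {S : ℕ} {k rj : Fin S → ℕ}
    (U : ∀ j : Fin S, Matrix (Fin (rj j)) (Fin (k j)) ℝ) :
    Matrix ((j : Fin S) × Fin (rj j)) ((j : Fin S) × Fin (k j)) ℝ :=
  fun p q => if h : q.1 = p.1 then U p.1 p.2 (h ▸ q.2) else 0

/-- Vertex embedding `f_i = W h_i`. -/
noncomputable def vertexEmb {m S : ℕ} {k rj : Fin S → ℕ}
    (U : ∀ j : Fin S, Matrix (Fin (rj j)) (Fin (k j)) ℝ)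
    (V : Fin m → ∀ j : Fin S, Fin (k j)) (i : Fin m) :
    ((j : Fin S) × Fin (rj j)) → ℝ :=
  (blockW U).mulVec (oneHot V i)

/-- The n-gram walk-set embedding `f₍ₙ₎`, summing the Hadamard products of the vertex
embeddings over walks of `n` vertices whose attribute values are pairwise distinct
within each attribute. -/
noncomputable def ngramEmbDistinct {m S : ℕ} {k rj : Fin S → ℕ}
    (A : Matrix (Fin m) (Fin m) ℝ)
    (V : Fin m → ∀ j : Fin S, Fin (k j))
    (U : ∀ j : Fin S, Matrix (Fin (rj j)) (Fin (k j)) ℝ)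
    (n : ℕ) : ((j : Fin S) × Fin (rj j)) → ℝ :=
  ∑ p ∈ Finset.univ.filter (fun p : Fin n → Fin m => IsDistinctWalk A V p),
    fun q => ∏ t : Fin n, vertexEmb U V (p t) q

/-- The block-diagonal matrix `T₍ₙ₎ = diag((U^0)^(n), …, (U^{S-1})^(n))` whose `j`-th block
is the `n`-way column Hadamard product of `U^j` (columns indexed by `n`-element subsets). -/
def Tn {S : ℕ} {k rj : Fin S → ℕ}
    (U : ∀ j : Fin S, Matrix (Fin (rj j)) (Fin (k j)) ℝ) (n : ℕ) :
    Matrix ((j : Fin S) × Fin (rj j))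
      ((j : Fin S) × {s : Finset (Fin (k j)) // s.card = n}) ℝ :=
  fun p q => if h : q.1 = p.1 then ∏ a ∈ q.2.1, U p.1 p.2 (h ▸ a) else 0

/-- The bag-of-n-cooccurrences vector `c₍ₙ₎`: the concatenation over attributes `j` of
`c₍ₙ₎^{(j)} = Σ_p e_p^{(j)}`, where `e_p^{(j)}` is the one-hot vector for the set of
`j`-th attribute values along the walk `p`. -/
noncomputable def bagOfCooc {m S : ℕ} {k : Fin S → ℕ}
    (A : Matrix (Fin m) (Fin m) ℝ)
    (V : Fin m → ∀ j : Fin S, Fin (k j)) (n : ℕ) :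
    ((j : Fin S) × {s : Finset (Fin (k j)) // s.card = n}) → ℝ :=
  fun q => ∑ p ∈ Finset.univ.filter (fun p : Fin n → Fin m => IsDistinctWalk A V p),
    if Finset.image (fun t : Fin n => V (p t) q.1) Finset.univ = q.2.1 then (1 : ℝ) else 0

/-- For block-diagonal `W = diag(U^0, …, U^{S-1})` and walks with pairwise
distinct attribute values within each attribute, the n-gram walk-set embedding satisfies
the exact linear identity `f₍ₙ₎ = T₍ₙ₎ c₍ₙ₎`. -/
theorem ngram_embedding_linear_identity
    (m S r n : ℕ) (k rj : Fin S → ℕ) (hr : ∑ j, rj j = r) (hn : 1 ≤ n)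
    (A : Matrix (Fin m) (Fin m) ℝ)
    (hA : ∀ i j, A i j = 0 ∨ A i j = 1)
    (V : Fin m → ∀ j : Fin S, Fin (k j))
    (U : ∀ j : Fin S, Matrix (Fin (rj j)) (Fin (k j)) ℝ) :
    ngramEmbDistinct A V U n = (Tn U n).mulVec (bagOfCooc A V n) := by
  have hv : ∀ (i : Fin m) (q : (j : Fin S) × Fin (rj j)),
      vertexEmb U V i q = U q.1 q.2 (V i q.1) := by
    rintro i ⟨j, x⟩
    unfold vertexEmb Matrix.mulVec dotProduct
    rw [Finset.sum_eq_single (⟨j, V i j⟩ : (j : Fin S) × Fin (k j))]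
    · simp [blockW, oneHot]
    · rintro ⟨j', y⟩ _ hne
      by_cases h : j' = j
      · subst h
        have : ¬ V i j' = y := by
          rintro rfl
          exact hne rfl
        simp [oneHot, this]
      · simp [blockW, h]
    · intro h
      exact absurd (Finset.mem_univ _) h
  funext q
  obtain ⟨j, x⟩ := q
  unfold ngramEmbDistinct Matrix.mulVec dotProduct bagOfCooc
  rw [Finset.sum_apply]
  simp only [Finset.mul_sum]
  rw [Finset.sum_comm]
  refine Finset.sum_congr rfl fun p hp => ?_
  have hinj := (Finset.mem_filter.1 hp).2.2 j
  have hcard : (Finset.image (fun t : Fin n => V (p t) j) Finset.univ).card = n := by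
    rw [Finset.card_image_of_injective _ hinj]
    simp
  rw [Finset.sum_eq_single (⟨j, ⟨_, hcard⟩⟩ :
    (j : Fin S) × {s : Finset (Fin (k j)) // s.card = n})]
  · simp only [hv, Tn, dif_pos, if_true, mul_one]
    rw [Finset.prod_image (fun a _ b _ h => hinj h)]
  · rintro ⟨j', y, hy⟩ _ hne
    by_cases h : j' = j
    · subst h
      rw [if_neg, mul_zero]
      intro h
      apply hne
      exact congrArg (Sigma.mk j') (Subtype.ext h.symm)
    · simp [Tn, h]
  · intro h
    exact absurd (Finset.mem_univ _) h
end

section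
/- (Concatenated linear identity used in the proof of Theorem 3.) Let W ∈ ℝ^{r×K} be block diagonal with blocks U^j ∈ ℝ^{r_j×k_j}, and for each n ∈ {1, …, T} let T_(n) be the block-diagonal matrix whose j-th block is the n-way column Hadamard product (U^j)^(n). Let T_[T] be the block-diagonal matrix with diagonal blocks T_(1), T_(2), …, T_(T). Then, for walks restricted so that attribute values along each walk are pairwise distinct within each attribute, the N-gram graph representation satisfies the exact linear identity f_G = T_[T] c_[T], where c_[T] is the concatenation of the bag-of-n-cooccurrences vectors c_(1), …, c_(T). -/
open scoped Classical

/-- Index set of the count statistics `c_[T]` (concatenation of `c₍₁₎, …, c₍T₎`). -/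
abbrev CIdx (S : ℕ) (k : Fin S → ℕ) (T : ℕ) : Type :=
  (t : Fin T) × ((j : Fin S) × {s : Finset (Fin (k j)) // s.card = (t : ℕ) + 1})

/-- The block-diagonal matrix `T_[T] = diag(T₍₁₎, …, T₍T₎)`, where the `j`-th block of
`T₍ₙ₎` is the `n`-way column Hadamard product `(U^j)^(n)`. -/
def TT {S : ℕ} {k rj : Fin S → ℕ} (T : ℕ)
    (U : ∀ j : Fin S, Matrix (Fin (rj j)) (Fin (k j)) ℝ) :
    Matrix (Fin T × ((j : Fin S) × Fin (rj j))) (CIdx S k T) ℝ :=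
  fun p q =>
    if q.1 = p.1 then
      if h : q.2.1 = p.2.1 then ∏ a ∈ q.2.2.1, U p.2.1 p.2.2 (h ▸ a) else 0
    else 0

theorem vertexEmb_apply {m S : ℕ} {k rj : Fin S → ℕ}
    (U : ∀ j : Fin S, Matrix (Fin (rj j)) (Fin (k j)) ℝ)
    (V : Fin m → ∀ j : Fin S, Fin (k j)) (i : Fin m) (j : Fin S) (a : Fin (rj j)) :
    vertexEmb U V i ⟨j, a⟩ = U j a (V i j) := by
  simp only [vertexEmb, Matrix.mulVec, dotProduct, Fintype.sum_sigma]
  rw [Finset.sum_eq_single j]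
  · simp [blockW, oneHot]
  · intro b _ hb
    simp [blockW, hb]
  · simp

/-- The concatenated exact linear identity `f_G = T_[T] c_[T]` for the
N-gram graph representation (walks restricted to pairwise distinct attribute values
within each attribute). -/
theorem ngram_concatenated_linear_identity
    (m S T : ℕ) (k rj : Fin S → ℕ)
    (A : Matrix (Fin m) (Fin m) ℝ)
    (hA : ∀ i j, A i j = 0 ∨ A i j = 1)
    (V : Fin m → ∀ j : Fin S, Fin (k j))
    (U : ∀ j : Fin S, Matrix (Fin (rj j)) (Fin (k j)) ℝ) :
    (fun p : Fin T × ((j : Fin S) × Fin (rj j)) =>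
        ngramEmbDistinct A V U ((p.1 : ℕ) + 1) p.2) =
      (TT T U).mulVec (fun q : CIdx S k T =>
        bagOfCooc A V ((q.1 : ℕ) + 1) q.2) := by
  funext p
  obtain ⟨t, j, a⟩ := p
  simp only [Matrix.mulVec, dotProduct, Fintype.sum_sigma]
  rw [Finset.sum_eq_single t, Finset.sum_eq_single j]
  · simp only [TT, if_true, dite_true, bagOfCooc, ngramEmbDistinct, Finset.sum_apply,
      Finset.mul_sum, vertexEmb_apply]
    rw [Finset.sum_comm]
    refine Finset.sum_congr rfl fun p hp => ?_
    have hinj := (Finset.mem_filter.mp hp).2.2 j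
    have hc : (Finset.image (fun s => V (p s) j) Finset.univ).card = (t : ℕ) + 1 := by
      rw [Finset.card_image_of_injective _ hinj]; simp
    rw [Finset.sum_eq_single ⟨_, hc⟩]
    · rw [if_pos rfl, mul_one, Finset.prod_image fun x _ y _ h => hinj h]
    · intro b _ hb
      rw [if_neg, mul_zero]
      intro h
      exact hb (Subtype.ext h.symm)
    · simp
  · intro b _ hb
    simp [TT, hb]
  · simp
  · intro b _ hb
    simp [TT, hb]
  · simp
end
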